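/- arXiv:1610.01735 — 5 statements merged into one kernel-verified Lean document; each statement's English description precedes it below -/
import Mathlib

section
/- For every real number κ with 0 < κ < 1 and every s with 1-κ < s < 1, the following weighted bounds hold: f_κ'(s)·exp(-2 f_κ(s)) ≤ 2/κ, (f_κ'(s))²·exp(-2 f_κ(s)) ≤ 4/κ², and f_κ''(s)·exp(-2 f_κ(s)) ≤ 4/κ², where f_κ'(s) = 2(s-1+κ)/(κ² - (s-1+κ)²) and f_κ''(s) = 2(κ² + (s-1+κ)²)/(κ² - (s-1+κ)²)². -/
/-- The conformal-factor profile `f_κ`: equal to `0` for `s ≤ 1-κ` and to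
`-log(1 - ((s-1+κ)/κ)²)` for `s > 1-κ`. -/
noncomputable def fkappa (κ s : ℝ) : ℝ :=
  if s ≤ 1 - κ then 0 else -Real.log (1 - ((s - 1 + κ) / κ) ^ 2)

/-- Where the profile is nonzero, the weight `exp (-2 f_κ)` is a rational function. -/
theorem exp_neg_two_mul_fkappa {κ s : ℝ} (hκ : 0 < κ) (hs1 : 1 - κ < s) (hs2 : s < 1) :
    Real.exp (-2 * fkappa κ s) = ((κ ^ 2 - (s - 1 + κ) ^ 2) / κ ^ 2) ^ 2 := by
  have hpos : 0 < 1 - ((s - 1 + κ) / κ) ^ 2 := by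
    have h0 : 0 ≤ (s - 1 + κ) / κ := div_nonneg (by linarith) hκ.le
    have h1 : (s - 1 + κ) / κ < 1 := (div_lt_one hκ).2 (by linarith)
    nlinarith
  rw [fkappa, if_neg hs1.not_ge, neg_mul_neg, mul_comm, Real.exp_mul, Real.exp_log hpos,
    Real.rpow_two]
  field_simp

theorem stmt_3 (κ s : ℝ) (hκ0 : 0 < κ) (hκ1 : κ < 1)
    (hs1 : 1 - κ < s) (hs2 : s < 1) :
    (2 * (s - 1 + κ) / (κ ^ 2 - (s - 1 + κ) ^ 2)) * Real.exp (-2 * fkappa κ s) ≤ 2 / κ ∧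
    (2 * (s - 1 + κ) / (κ ^ 2 - (s - 1 + κ) ^ 2)) ^ 2 * Real.exp (-2 * fkappa κ s) ≤ 4 / κ ^ 2 ∧
    (2 * (κ ^ 2 + (s - 1 + κ) ^ 2) / (κ ^ 2 - (s - 1 + κ) ^ 2) ^ 2) *
        Real.exp (-2 * fkappa κ s) ≤ 4 / κ ^ 2 := by
  rw [exp_neg_two_mul_fkappa hκ0 hs1 hs2]
  obtain ⟨t, ht⟩ : ∃ t, t = s - 1 + κ := ⟨_, rfl⟩
  rw [← ht]
  have ht0 : 0 < t := by linarith
  have htκ : t < κ := by linarith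
  have hsq : t ^ 2 < κ ^ 2 := by gcongr
  have hd : κ ^ 2 - t ^ 2 ≠ 0 := (sub_pos.2 hsq).ne'
  refine ⟨?_, ?_, ?_⟩
  · calc 2 * t / (κ ^ 2 - t ^ 2) * ((κ ^ 2 - t ^ 2) / κ ^ 2) ^ 2
        = 2 * (t * (κ ^ 2 - t ^ 2)) / κ ^ 4 := by field_simp
      _ ≤ 2 * (κ * κ ^ 2) / κ ^ 4 := by
        gcongr
        exact sub_le_self _ (sq_nonneg t)
      _ = 2 / κ := by field_simp
  · calc (2 * t / (κ ^ 2 - t ^ 2)) ^ 2 * ((κ ^ 2 - t ^ 2) / κ ^ 2) ^ 2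
        = 4 * t ^ 2 / κ ^ 4 := by field_simp; ring
      _ ≤ 4 * κ ^ 2 / κ ^ 4 := by gcongr
      _ = 4 / κ ^ 2 := by field_simp
  · calc 2 * (κ ^ 2 + t ^ 2) / (κ ^ 2 - t ^ 2) ^ 2 * ((κ ^ 2 - t ^ 2) / κ ^ 2) ^ 2
        = 2 * (κ ^ 2 + t ^ 2) / κ ^ 4 := by field_simp
      _ ≤ 2 * (κ ^ 2 + κ ^ 2) / κ ^ 4 := by gcongr
      _ = 4 / κ ^ 2 := by field_simp; ring
end

section
/- For all real numbers κ, β, a with 0 < κ < 1, 0 < β < κ, 0 < a ≤ 1/8, and aκ < β, the number α := ( -(κ² - 2aκβ) + √((κ² - 2aκβ)² + 4(aκ)²(κ² - β²)) ) / (2aκ) satisfies α < 2a(κ² - β²)/κ, α < 4a(κ - β), and α + β < (κ + β)/2. -/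
theorem stmt_7 (κ β a : ℝ) (hκ0 : 0 < κ) (hκ1 : κ < 1) (hβ0 : 0 < β) (hβκ : β < κ)
    (ha0 : 0 < a) (ha8 : a ≤ 1 / 8) (haκβ : a * κ < β) :
    (-(κ ^ 2 - 2 * (a * κ) * β) +
        Real.sqrt ((κ ^ 2 - 2 * (a * κ) * β) ^ 2 + 4 * (a * κ) ^ 2 * (κ ^ 2 - β ^ 2))) /
      (2 * (a * κ)) < 2 * a * (κ ^ 2 - β ^ 2) / κ ∧
    (-(κ ^ 2 - 2 * (a * κ) * β) +
        Real.sqrt ((κ ^ 2 - 2 * (a * κ) * β) ^ 2 + 4 * (a * κ) ^ 2 * (κ ^ 2 - β ^ 2))) /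
      (2 * (a * κ)) < 4 * a * (κ - β) ∧
    (-(κ ^ 2 - 2 * (a * κ) * β) +
        Real.sqrt ((κ ^ 2 - 2 * (a * κ) * β) ^ 2 + 4 * (a * κ) ^ 2 * (κ ^ 2 - β ^ 2))) /
      (2 * (a * κ)) + β < (κ + β) / 2 := by
  have hD : 0 < κ ^ 2 - β ^ 2 := by nlinarith
  have hc : κ ^ 2 < 2 * (κ ^ 2 - 2 * (a * κ) * β) := by
    have h1 : a * (κ * β) ≤ 1 / 8 * (κ * β) := by gcongr
    nlinarith
  have hκβ : 0 < κ - β := sub_pos.mpr hβκ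
  have hsqrt : Real.sqrt ((κ ^ 2 - 2 * (a * κ) * β) ^ 2 + 4 * (a * κ) ^ 2 * (κ ^ 2 - β ^ 2)) <
      (κ ^ 2 - 2 * (a * κ) * β) + 4 * a ^ 2 * (κ ^ 2 - β ^ 2) := by
    have hpos : 0 < 4 * a ^ 2 * (κ ^ 2 - β ^ 2) := by positivity
    rw [Real.sqrt_lt' (by nlinarith)]
    generalize κ ^ 2 - 2 * (a * κ) * β = c at *
    nlinarith [mul_pos hpos (sub_pos.mpr hc), sq_nonneg (4 * a ^ 2 * (κ ^ 2 - β ^ 2))]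
  have hfirst : (-(κ ^ 2 - 2 * (a * κ) * β) +
        Real.sqrt ((κ ^ 2 - 2 * (a * κ) * β) ^ 2 + 4 * (a * κ) ^ 2 * (κ ^ 2 - β ^ 2))) /
      (2 * (a * κ)) < 2 * a * (κ ^ 2 - β ^ 2) / κ := by
    rw [div_lt_iff₀ (by positivity)]
    have heq : 2 * a * (κ ^ 2 - β ^ 2) / κ * (2 * (a * κ)) = 4 * a ^ 2 * (κ ^ 2 - β ^ 2) := by
      field_simp
      ring
    linarith
  have hsecond : 2 * a * (κ ^ 2 - β ^ 2) / κ < 4 * a * (κ - β) := by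
    rw [div_lt_iff₀ hκ0]
    nlinarith [mul_pos ha0 (mul_pos hκβ hκβ)]
  have hthird : 4 * a * (κ - β) ≤ (κ - β) / 2 := by nlinarith
  exact ⟨hfirst, hfirst.trans hsecond, by linarith⟩
end

section
/- For all real numbers κ, β, α, a with 0 < κ < 1, 0 < β < κ, 0 < a ≤ 1/8, 0 < α < β, α < 4a(κ - β), and α + β < (κ + β)/2, the following bounds hold: 0 < 4αβ/(κ² - (β+α)²) < 32a and 0 < 4αβ/(κ² - (β-α)²) < 16a. -/
theorem stmt_9 (κ β α a : ℝ) (hκ0 : 0 < κ) (hκ1 : κ < 1) (hβ0 : 0 < β) (hβκ : β < κ)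
    (ha0 : 0 < a) (ha8 : a ≤ 1 / 8) (hα0 : 0 < α) (hαβ : α < β)
    (hα4a : α < 4 * a * (κ - β)) (hsum : α + β < (κ + β) / 2) :
    (0 < 4 * α * β / (κ ^ 2 - (β + α) ^ 2) ∧ 4 * α * β / (κ ^ 2 - (β + α) ^ 2) < 32 * a) ∧
    (0 < 4 * α * β / (κ ^ 2 - (β - α) ^ 2) ∧ 4 * α * β / (κ ^ 2 - (β - α) ^ 2) < 16 * a) := by
  have hδ : 0 < κ - β := sub_pos.mpr hβκ
  have hnum : 0 < 4 * α * β := by positivity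
  have hαβ' : α * β < 4 * a * (κ - β) * β := mul_lt_mul_of_pos_right hα4a hβ0
  have hsum_den : (κ - β) / 2 * β < κ ^ 2 - (β + α) ^ 2 := by
    have h : (κ - β) / 2 * β < (κ - (β + α)) * (κ + (β + α)) :=
      mul_lt_mul'' (by linarith) (by linarith) (by linarith) hβ0.le
    linarith
  have hsub_den : (κ - β) * β < κ ^ 2 - (β - α) ^ 2 := by
    have h : (κ - β) * β < (κ - (β - α)) * (κ + (β - α)) :=
      mul_lt_mul'' (by linarith) (by linarith) hδ.le hβ0.le
    linarith
  have hδβ : 0 < (κ - β) * β := mul_pos hδ hβ0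
  have hsum_pos : 0 < κ ^ 2 - (β + α) ^ 2 := by linarith
  have hsub_pos : 0 < κ ^ 2 - (β - α) ^ 2 := by linarith
  refine ⟨⟨div_pos hnum hsum_pos, ?_⟩, ⟨div_pos hnum hsub_pos, ?_⟩⟩
  · rw [div_lt_iff₀ hsum_pos]
    linarith [mul_lt_mul_of_pos_left hsum_den ha0]
  · rw [div_lt_iff₀ hsub_pos]
    linarith [mul_lt_mul_of_pos_left hsub_den ha0]
end

section
/- For every ε > 0 there exists a real number a with 0 < a ≤ 1/8 such that for every κ with 0 < κ < 1 and every β with 0 < β < κ, letting α be the unique element of [0,1) with φ(α) = aκ and setting d = 1-κ+β, one has d + α < 1 and |f̃_κ(d+α) - f̃_κ(d-α)| < ε. (The constant a depends only on ε, not on κ, β.) -/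
/-- The function `φ`: `φ(α) = ακ²/(κ² - (β-α)²)` for `α < β` and `φ(α) = α` for `α ≥ β`. -/
noncomputable def phi (κ β α : ℝ) : ℝ :=
  if α < β then α * κ ^ 2 / (κ ^ 2 - (β - α) ^ 2) else α

/-- `fkappa` at distance `u` beyond `1 - κ`, in the rescaled variable `u / κ`. -/
lemma fkappa_add_of_pos {κ u : ℝ} (hu : 0 < u) :
    fkappa κ (1 - κ + u) = -Real.log (1 - (u / κ) ^ 2) := by
  rw [fkappa, if_neg (by linarith)]
  ring_nf

lemma neg_log_one_sub_le_two_mul {t : ℝ} (h0 : 0 ≤ t) (h1 : t ≤ 1 / 2) :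
    -Real.log (1 - t) ≤ 2 * t := by
  have hpos : 0 < 1 - t := by linarith
  have hlog := Real.one_sub_inv_le_log_of_pos hpos
  have hinv : (1 - t)⁻¹ ≤ 1 + 2 * t := by
    rw [inv_le_iff_one_le_mul₀ hpos]
    nlinarith
  linarith

lemma neg_log_one_sub_nonneg {t : ℝ} (h0 : 0 ≤ t) (h1 : t ≤ 1 / 2) :
    0 ≤ -Real.log (1 - t) :=
  neg_nonneg.2 (Real.log_nonpos (by linarith) (by linarith))

/-- The oscillation bound when `β ≤ α`, where `phi κ β α = α`. -/
lemma fkappa_oscillation_of_le {a κ β α : ℝ} (ha : a ≤ 1 / 8) (hκ : 0 < κ)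
    (hβ : 0 < β) (hβα : β ≤ α) (hα : α = a * κ) :
    (1 - κ + β) + α < 1 ∧
      |fkappa κ ((1 - κ + β) + α) - fkappa κ ((1 - κ + β) - α)| ≤ 8 * a := by
  have hsum0 : 0 < β + α := by linarith
  have hx0 : 0 < (β + α) / κ := div_pos hsum0 hκ
  have hx : (β + α) / κ ≤ 2 * a := by
    rw [div_le_iff₀ hκ]
    linarith
  have ht : ((β + α) / κ) ^ 2 ≤ a := by nlinarith
  have hzero : fkappa κ ((1 - κ + β) - α) = 0 := if_pos (by linarith)
  refine ⟨by nlinarith, ?_⟩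
  rw [hzero, sub_zero, add_assoc, fkappa_add_of_pos hsum0,
    abs_of_nonneg (neg_log_one_sub_nonneg (sq_nonneg _) (by linarith))]
  linarith [neg_log_one_sub_le_two_mul (sq_nonneg ((β + α) / κ)) (by linarith)]

/-- The oscillation bound when `α < β`: there `1 - ((β + α) / κ) ^ 2` is
`(1 - ((β - α) / κ) ^ 2) * (1 - 4 * a * (β / κ))`. -/
lemma fkappa_oscillation_of_lt {a κ β α : ℝ} (ha0 : 0 < a) (ha : a ≤ 1 / 8) (hκ : 0 < κ)
    (hβ : 0 < β) (hβκ : β < κ) (hα0 : 0 ≤ α) (hαβ : α < β)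
    (hα : α * κ ^ 2 / (κ ^ 2 - (β - α) ^ 2) = a * κ) :
    (1 - κ + β) + α < 1 ∧
      |fkappa κ ((1 - κ + β) + α) - fkappa κ ((1 - κ + β) - α)| ≤ 8 * a := by
  have hD : 0 < κ ^ 2 - (β - α) ^ 2 := by nlinarith
  rw [div_eq_iff hD.ne'] at hα
  have hακ : α * κ = a * (κ ^ 2 - (β - α) ^ 2) :=
    mul_right_cancel₀ hκ.ne' (by linear_combination hα)
  have hx0 : 0 < β / κ := div_pos hβ hκ
  have hx1 : β / κ < 1 := (div_lt_one hκ).2 hβκ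
  have ht0 : 0 ≤ 4 * a * (β / κ) := by positivity
  have ht : 4 * a * (β / κ) ≤ 4 * a := by nlinarith
  have hE : 0 < 1 - ((β - α) / κ) ^ 2 := by
    rw [div_pow, sub_pos, div_lt_one (by positivity)]
    linarith
  have hfac : 1 - ((β + α) / κ) ^ 2 =
      (1 - ((β - α) / κ) ^ 2) * (1 - 4 * a * (β / κ)) := by
    field_simp
    linear_combination (-4 * β) * hακ
  have hsum : (β + α) / κ < 1 := by
    have := mul_pos hE (show 0 < 1 - 4 * a * (β / κ) by linarith)
    rw [← hfac] at this
    nlinarith [show 0 ≤ (β + α) / κ by positivity]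
  rw [div_lt_one hκ] at hsum
  refine ⟨by linarith, ?_⟩
  rw [add_assoc, fkappa_add_of_pos (by linarith), add_sub_assoc,
    fkappa_add_of_pos (by linarith), hfac, Real.log_mul hE.ne' (by linarith), neg_add,
    add_sub_cancel_left,
    abs_of_nonneg (neg_log_one_sub_nonneg ht0 (by linarith))]
  linarith [neg_log_one_sub_le_two_mul ht0 (by linarith)]

theorem stmt_11 :
    ∀ ε : ℝ, 0 < ε → ∃ a : ℝ, 0 < a ∧ a ≤ 1 / 8 ∧
      ∀ κ β α : ℝ, 0 < κ → κ < 1 → 0 < β → β < κ →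
        α ∈ Set.Ico (0 : ℝ) 1 → phi κ β α = a * κ →
        (1 - κ + β) + α < 1 ∧
        |fkappa κ ((1 - κ + β) + α) - fkappa κ ((1 - κ + β) - α)| < ε := by
  intro ε hε
  refine ⟨min (1 / 8) (ε / 16), by positivity, min_le_left _ _, ?_⟩
  intro κ β α hκ _ hβ hβκ hα hphi
  have hε8 : 8 * min (1 / 8) (ε / 16) < ε := by linarith [min_le_right (1 / 8) (ε / 16)]
  rw [phi] at hphi
  split_ifs at hphi with hαβ
  · exact (fkappa_oscillation_of_lt (by positivity) (min_le_left _ _) hκ hβ hβκ hα.1 hαβ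
      hphi).imp_right fun h => h.trans_lt hε8
  · exact (fkappa_oscillation_of_le (min_le_left _ _) hκ hβ (not_lt.1 hαβ)
      hphi).imp_right fun h => h.trans_lt hε8
end

section
/- Let n ≥ 3 be a natural number and let ρ, κ, C₀ be positive reals and k, l nonnegative reals. Let F, P, Q, S, X, Y be real numbers with F ≥ 0, P ≥ 0, Q ≥ 0, S ≥ -k, |X| ≤ C₀, |Y| ≤ C₀√l, P·e^{-2F} ≤ 2/κ, P²·e^{-2F} ≤ 4/κ², and Q·e^{-2F} ≤ 4/κ². Then e^{-2F}·( S - (4(n-1)/(n-2))·( ((n-2)/(2ρ))²·P²·X² + ((n-2)/(2ρ²))·Q·X² + ((n-2)/(2ρ))·P·Y ) ) ≥ -k - 4n(n-1)·C₀²/(ρ²κ²) - 4(n-1)·C₀·√l/(ρκ). -/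
theorem stmt_15 (n : ℕ) (hn : 3 ≤ n) (ρ κ C₀ k l : ℝ)
    (hρ : 0 < ρ) (hκ : 0 < κ) (hC₀ : 0 < C₀) (hk : 0 ≤ k) (hl : 0 ≤ l)
    (F P Q S X Y : ℝ) (hF : 0 ≤ F) (hP : 0 ≤ P) (hQ : 0 ≤ Q) (hS : -k ≤ S)
    (hX : |X| ≤ C₀) (hY : |Y| ≤ C₀ * Real.sqrt l)
    (h1 : P * Real.exp (-2 * F) ≤ 2 / κ)
    (h2 : P ^ 2 * Real.exp (-2 * F) ≤ 4 / κ ^ 2)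
    (h3 : Q * Real.exp (-2 * F) ≤ 4 / κ ^ 2) :
    -k - 4 * (n : ℝ) * ((n : ℝ) - 1) * C₀ ^ 2 / (ρ ^ 2 * κ ^ 2)
        - 4 * ((n : ℝ) - 1) * C₀ * Real.sqrt l / (ρ * κ) ≤
      Real.exp (-2 * F) *
        (S - (4 * ((n : ℝ) - 1) / ((n : ℝ) - 2)) *
          ((((n : ℝ) - 2) / (2 * ρ)) ^ 2 * P ^ 2 * X ^ 2 +
            (((n : ℝ) - 2) / (2 * ρ ^ 2)) * Q * X ^ 2 +
            (((n : ℝ) - 2) / (2 * ρ)) * P * Y)) := by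
  have hn' : (3 : ℝ) ≤ n := by exact_mod_cast hn
  have hn1 : 0 ≤ (n : ℝ) - 1 := by linarith
  have hn2 : 0 < (n : ℝ) - 2 := by linarith
  have hne : (n : ℝ) - 2 ≠ 0 := hn2.ne'
  have hE1 : Real.exp (-2 * F) ≤ 1 := Real.exp_le_one_iff.mpr (by linarith)
  have hE : 0 < Real.exp (-2 * F) := Real.exp_pos _
  generalize Real.exp (-2 * F) = E at *
  have hX2 : X ^ 2 ≤ C₀ ^ 2 := sq_le_sq' (abs_le.mp hX).1 (abs_le.mp hX).2
  have hSE : -k ≤ E * S := by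
    linarith [mul_le_mul_of_nonneg_left hS hE.le, mul_le_mul_of_nonneg_right hE1 hk]
  have hPX : P ^ 2 * E * X ^ 2 ≤ 4 / κ ^ 2 * C₀ ^ 2 := by gcongr
  have hQX : Q * E * X ^ 2 ≤ 4 / κ ^ 2 * C₀ ^ 2 := by gcongr
  have hPY : P * E * Y ≤ 2 / κ * (C₀ * Real.sqrt l) :=
    (mul_le_mul_of_nonneg_left ((le_abs_self Y).trans hY) (by positivity)).trans
      (mul_le_mul_of_nonneg_right h1 (by positivity))
  have hPX' := mul_le_mul_of_nonneg_left hPX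
    (by positivity : 0 ≤ ((n : ℝ) - 1) * ((n : ℝ) - 2) / ρ ^ 2)
  have hQX' := mul_le_mul_of_nonneg_left hQX
    (by positivity : 0 ≤ 2 * ((n : ℝ) - 1) / ρ ^ 2)
  have hPY' := mul_le_mul_of_nonneg_left hPY
    (by positivity : 0 ≤ 2 * ((n : ℝ) - 1) / ρ)
  calc
    _ = -k - ((n : ℝ) - 1) * ((n : ℝ) - 2) / ρ ^ 2 * (4 / κ ^ 2 * C₀ ^ 2)
          - 2 * ((n : ℝ) - 1) / ρ ^ 2 * (4 / κ ^ 2 * C₀ ^ 2)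
          - 2 * ((n : ℝ) - 1) / ρ * (2 / κ * (C₀ * Real.sqrt l)) := by
      field_simp
      ring
    _ ≤ E * S - ((n : ℝ) - 1) * ((n : ℝ) - 2) / ρ ^ 2 * (P ^ 2 * E * X ^ 2)
          - 2 * ((n : ℝ) - 1) / ρ ^ 2 * (Q * E * X ^ 2)
          - 2 * ((n : ℝ) - 1) / ρ * (P * E * Y) := by linarith
    _ = _ := by
      field_simp
      ring
end
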